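/- Let N ≥ 2, n ≥ 0, and let (L_1, …, L_N) be a Lagrangian 1-form (each L_m a jet function of order n), and let u: ℝ^N → ℝ be smooth. For p ∈ ℝ^N, distinct indices i ≠ j, and a, b > 0, consider the L-shaped curve consisting of the segment s ↦ p − (a−s)e_i, s ∈ [0,a], followed by the segment s ↦ p + s·e_j, s ∈ [0,b], and define the action of a smooth field w along it by A(w) := ∫₀^a L_i[w](p−(a−s)e_i) ds + ∫₀^b L_j[w](p+s·e_j) ds. Then the following are equivalent: (1) for every such L-shaped curve (every p, i ≠ j, a, b > 0) and every smooth φ: ℝ^N → ℝ with compact support disjoint from the two outer endpoints p − a·e_i and p + b·e_j, one has d/dε|_{ε=0} A(u+εφ) = 0; (2) u satisfies everywhere on ℝ^N the multi-time Euler–Lagrange equations: (δ_i L_i/δu_I)[u] = 0 for every i and every multi-index I with I_i = 0, and (δ_i L_i/δu_{I+e_i})[u] = (δ_j L_j/δu_{I+e_j})[u] for all i ≠ j and every multi-index I. -/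

import Mathlib

noncomputable section

/-- The partial derivative of `f : ℝ^N → ℝ` in the `i`-th coordinate direction. -/
def pd {N : ℕ} (i : Fin N) (f : (Fin N → ℝ) → ℝ) : (Fin N → ℝ) → ℝ :=
  fun t => fderiv ℝ f t (Pi.single i 1)

/-- The iterated partial derivative `∂^I = ∂_1^{I_1} ⋯ ∂_N^{I_N}`. -/
def pdMulti {N : ℕ} (I : Fin N → ℕ) (f : (Fin N → ℝ) → ℝ) : (Fin N → ℝ) → ℝ :=
  ((List.ofFn fun m : Fin N => (pd m)^[I m]).foldr (· ∘ ·) id) f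


/-- The `i`-th coordinate unit vector in `ℝ^N`. -/
def unitVec {N : ℕ} (i : Fin N) : Fin N → ℝ := Pi.single i 1

instance jetFintype (N n : ℕ) : Fintype {I : Fin N → ℕ // ∑ m, I m ≤ n} :=
  Fintype.ofInjective
    (fun I => (fun m => (⟨I.1 m, Nat.lt_succ_of_le
      ((Finset.single_le_sum (f := I.1) (fun _ _ => Nat.zero_le _)
        (Finset.mem_univ m)).trans I.2)⟩ : Fin (n + 1))) : _ → (Fin N → Fin (n + 1)))
    (fun I J h => Subtype.ext (funext fun m => congrArg Fin.val (congrFun h m)))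

/-- The space of jet variables `(u_I)_{|I| ≤ n}` of order `n`. -/
abbrev JetSpace (N n : ℕ) := {I : Fin N → ℕ // ∑ m, I m ≤ n} → ℝ

/-- The `n`-jet of a field `w` at the point `t`. -/
def jet {N : ℕ} (n : ℕ) (w : (Fin N → ℝ) → ℝ) (t : Fin N → ℝ) : JetSpace N n :=
  fun I => pdMulti I.1 w t

/-- Evaluation `L[w]` of a jet function on the jet of a field `w`. -/
def jev {N n : ℕ} (L : JetSpace N n → ℝ) (w : (Fin N → ℝ) → ℝ) : (Fin N → ℝ) → ℝ :=
  fun t => L (jet n w t)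

/-- `(∂L/∂u_I)[w]`: the partial derivative of the jet function `L` with respect to the jet
variable `u_I`, evaluated on the jet of `w` (zero when `|I| > n`). -/
def pjet {N n : ℕ} (L : JetSpace N n → ℝ) (I : Fin N → ℕ) (w : (Fin N → ℝ) → ℝ) :
    (Fin N → ℝ) → ℝ :=
  fun t => if h : ∑ m, I m ≤ n then fderiv ℝ L (jet n w t) (Pi.single ⟨I, h⟩ 1) else 0

/-- The variational derivative in the coordinate direction `i`:
`(δ_i L/δu_I)[w] = Σ_α (−1)^α D_i^α ((∂L/∂u_{I+α·e_i})[w])`. -/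
def varDer {N n : ℕ} (i : Fin N) (L : JetSpace N n → ℝ) (I : Fin N → ℕ)
    (w : (Fin N → ℝ) → ℝ) : (Fin N → ℝ) → ℝ :=
  ∑ᶠ α : ℕ, (-1 : ℝ) ^ α • (pd i)^[α] (pjet L (I + α • Pi.single i 1) w)

/-- Smoothness of a field. -/
abbrev Sm {N : ℕ} (f : (Fin N → ℝ) → ℝ) : Prop := ContDiff ℝ (⊤ : ℕ∞) f

lemma Sm.diff {N : ℕ} {f : (Fin N → ℝ) → ℝ} (hf : Sm f) : Differentiable ℝ f :=
  hf.differentiable (by simp)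

lemma Sm.pd {N : ℕ} {f : (Fin N → ℝ) → ℝ} (hf : Sm f) (i : Fin N) : Sm (pd i f) := by
  have h : ContDiff ℝ (⊤ : ℕ∞) (fderiv ℝ f) := hf.fderiv_right (by simp)
  exact h.clm_apply contDiff_const

lemma Sm.pd_iter {N : ℕ} {f : (Fin N → ℝ) → ℝ} (hf : Sm f) (i : Fin N) (k : ℕ) :
    Sm ((_root_.pd i)^[k] f) := by
  induction k generalizing f with
  | zero => exact hf
  | succ k ih => exact ih (hf.pd i)

lemma pd_add {N : ℕ} (i : Fin N) {f g : (Fin N → ℝ) → ℝ} (hf : Sm f) (hg : Sm g) :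
    pd i (f + g) = pd i f + pd i g := by
  funext t
  simp [pd, fderiv_add (hf.diff t) (hg.diff t)]

lemma pd_smul {N : ℕ} (i : Fin N) (c : ℝ) {f : (Fin N → ℝ) → ℝ} (hf : Sm f) :
    pd i (c • f) = c • pd i f := by
  funext t
  simp [pd, fderiv_const_smul (hf.diff t)]

lemma pd_mul {N : ℕ} (i : Fin N) {f g : (Fin N → ℝ) → ℝ} (hf : Sm f) (hg : Sm g) :
    pd i (f * g) = pd i f * g + f * pd i g := by
  funext t
  simp [pd, fderiv_mul (hf.diff t) (hg.diff t)]
  ring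

lemma pd_zero {N : ℕ} (i : Fin N) : pd i (0 : (Fin N → ℝ) → ℝ) = 0 := by
  funext t
  simp [pd]

lemma pd_iter_zero {N : ℕ} (i : Fin N) (k : ℕ) : (pd i)^[k] (0 : (Fin N → ℝ) → ℝ) = 0 := by
  induction k with
  | zero => rfl
  | succ k ih => rw [Function.iterate_succ_apply, pd_zero, ih]

lemma Sm.csmul {N : ℕ} {f : (Fin N → ℝ) → ℝ} (hf : Sm f) (c : ℝ) : Sm (c • f) :=
  hf.const_smul c

lemma Sm_zero {N : ℕ} : Sm (0 : (Fin N → ℝ) → ℝ) := contDiff_const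

lemma Sm_sum {N : ℕ} {ι : Type*} (s : Finset ι) (f : ι → (Fin N → ℝ) → ℝ)
    (hf : ∀ k ∈ s, Sm (f k)) : Sm (∑ k ∈ s, f k) := by
  classical
  induction s using Finset.induction_on with
  | empty => simpa using Sm_zero
  | insert a s ha ih =>
    rw [Finset.sum_insert ha]
    exact (hf a (by simp)).add (ih fun k hk => hf k (by simp [hk]))

lemma pd_sum {N : ℕ} (i : Fin N) {ι : Type*} (s : Finset ι) (f : ι → (Fin N → ℝ) → ℝ)
    (hf : ∀ k ∈ s, Sm (f k)) : pd i (∑ k ∈ s, f k) = ∑ k ∈ s, pd i (f k) := by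
  classical
  induction s using Finset.induction_on with
  | empty => simpa using pd_zero i
  | insert a s ha ih =>
    rw [Finset.sum_insert ha, Finset.sum_insert ha, pd_add i (hf a (by simp))
      (Sm_sum s f fun k hk => hf k (by simp [hk])), ih fun k hk => hf k (by simp [hk])]

lemma pd_comm {N : ℕ} (i j : Fin N) {f : (Fin N → ℝ) → ℝ} (hf : Sm f) :
    pd i (pd j f) = pd j (pd i f) := by
  funext t
  have h : ContDiff ℝ (⊤ : ℕ∞) (fderiv ℝ f) := hf.fderiv_right (by simp)
  have h' : DifferentiableAt ℝ (fderiv ℝ f) t := h.differentiable (by simp) t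
  have hs : IsSymmSndFDerivAt ℝ f t := hf.contDiffAt.isSymmSndFDerivAt (by
    simp only [minSmoothness_of_isRCLikeNormedField]
    exact WithTop.coe_le_coe.2 (le_top : (2 : ℕ∞) ≤ ⊤))
  have key : ∀ a b : Fin N → ℝ, fderiv ℝ (fun x => fderiv ℝ f x a) t b
      = fderiv ℝ (fderiv ℝ f) t b a := by
    intro a b
    rw [fderiv_clm_apply h' (differentiableAt_const a)]
    simp
  change fderiv ℝ (fun x => fderiv ℝ f x (Pi.single j 1)) t (Pi.single i 1)
    = fderiv ℝ (fun x => fderiv ℝ f x (Pi.single i 1)) t (Pi.single j 1)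
  rw [key, key]
  exact hs _ _

lemma pd_pd_iter {N : ℕ} (i j : Fin N) (k : ℕ) {f : (Fin N → ℝ) → ℝ} (hf : Sm f) :
    pd i ((pd j)^[k] f) = (pd j)^[k] (pd i f) := by
  induction k generalizing f with
  | zero => rfl
  | succ k ih => rw [Function.iterate_succ_apply, Function.iterate_succ_apply, ih (hf.pd j),
      pd_comm i j hf]

/-- Iterated partial derivatives along a list of directions. -/
def pdList {N : ℕ} (I : Fin N → ℕ) : List (Fin N) → ((Fin N → ℝ) → ℝ) → ((Fin N → ℝ) → ℝ)
  | [], f => f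
  | m :: l, f => (pd m)^[I m] (pdList I l f)

lemma pdMulti_eq {N : ℕ} (I : Fin N → ℕ) (f : (Fin N → ℝ) → ℝ) :
    pdMulti I f = pdList I (List.finRange N) f := by
  unfold pdMulti
  rw [List.ofFn_eq_map]
  generalize List.finRange N = l
  induction l with
  | nil => rfl
  | cons m l ih => simp only [List.map_cons, List.foldr_cons, Function.comp_apply, pdList, ih]

lemma pdList_sm {N : ℕ} (I : Fin N → ℕ) (l : List (Fin N)) {f : (Fin N → ℝ) → ℝ} (hf : Sm f) :
    Sm (pdList I l f) := by
  induction l with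
  | nil => exact hf
  | cons m l ih => exact ih.pd_iter m _

lemma pdList_add_notMem {N : ℕ} (I : Fin N → ℕ) (i : Fin N) (l : List (Fin N)) (hl : i ∉ l)
    (f : (Fin N → ℝ) → ℝ) : pdList (I + Pi.single i 1) l f = pdList I l f := by
  induction l with
  | nil => rfl
  | cons m l ih =>
    simp only [List.mem_cons, not_or] at hl
    simp only [pdList, ih hl.2]
    simp [Pi.single_eq_of_ne (Ne.symm hl.1)]

lemma pdList_add_mem {N : ℕ} (I : Fin N → ℕ) (i : Fin N) (l : List (Fin N)) (hn : l.Nodup)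
    (hl : i ∈ l) {f : (Fin N → ℝ) → ℝ} (hf : Sm f) :
    pdList (I + Pi.single i 1) l f = pd i (pdList I l f) := by
  induction l with
  | nil => simp at hl
  | cons m l ih =>
    rw [List.nodup_cons] at hn
    simp only [pdList]
    by_cases him : i = m
    · subst him
      rw [pdList_add_notMem I i l hn.1 f]
      simp only [Pi.add_apply, Pi.single_eq_same, Function.iterate_succ_apply']
    · have hil : i ∈ l := by simpa [him] using hl
      rw [ih hn.2 hil, pd_pd_iter i m _ (pdList_sm I l hf)]
      simp [Pi.single_eq_of_ne (Ne.symm him)]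

lemma pdMulti_add_single {N : ℕ} (I : Fin N → ℕ) (i : Fin N) {f : (Fin N → ℝ) → ℝ} (hf : Sm f) :
    pdMulti (I + Pi.single i 1) f = pd i (pdMulti I f) := by
  rw [pdMulti_eq, pdMulti_eq]
  exact pdList_add_mem I i _ (List.nodup_finRange N) (List.mem_finRange i) hf

lemma pdMulti_zero {N : ℕ} (f : (Fin N → ℝ) → ℝ) : pdMulti (0 : Fin N → ℕ) f = f := by
  rw [pdMulti_eq]
  generalize List.finRange N = l
  induction l with
  | nil => rfl
  | cons m l ih => simpa [pdList] using ih

lemma Sm.pdMulti {N : ℕ} {f : (Fin N → ℝ) → ℝ} (hf : Sm f) (I : Fin N → ℕ) :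
    Sm (pdMulti I f) := by
  rw [pdMulti_eq]
  exact pdList_sm I _ hf

lemma multi_induction {N : ℕ} {P : (Fin N → ℕ) → Prop} (h0 : P 0)
    (hs : ∀ I i, P I → P (I + Pi.single i 1)) (I : Fin N → ℕ) : P I := by
  induction hk : ∑ m, I m generalizing I with
  | zero =>
    have : I = 0 := by
      funext m
      simpa using (Finset.sum_eq_zero_iff.mp hk) m (Finset.mem_univ m)
    exact this ▸ h0
  | succ k ih =>
    have : ∃ i, I i ≠ 0 := by
      by_contra! h
      simp [h] at hk
    obtain ⟨i, hi⟩ := this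
    have e : I = (I - Pi.single i 1) + Pi.single i 1 := by
      funext m
      by_cases hm : m = i
      · subst hm; simp; omega
      · simp [Pi.single_eq_of_ne hm]
    rw [e]
    apply hs
    apply ih
    rw [e] at hk
    simp only [Pi.add_apply, Finset.sum_add_distrib, Finset.sum_pi_single', Finset.mem_univ,
      if_true] at hk
    simpa using hk

lemma pdMulti_lin {N : ℕ} (I : Fin N → ℕ) {f g : (Fin N → ℝ) → ℝ} (hf : Sm f) (hg : Sm g)
    (ε : ℝ) : pdMulti I (f + ε • g) = pdMulti I f + ε • pdMulti I g := by
  have hfg : Sm (f + ε • g) := hf.add (hg.const_smul ε)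
  induction I using multi_induction with
  | h0 => simp [pdMulti_zero]
  | hs I i ih =>
    have h2 : Sm (ε • pdMulti I g) := (hg.pdMulti I).const_smul ε
    rw [pdMulti_add_single I i hfg, ih, pd_add i (hf.pdMulti I) h2, pd_smul i ε (hg.pdMulti I),
      pdMulti_add_single I i hf, pdMulti_add_single I i hg]

lemma jet_lin {N : ℕ} (n : ℕ) {f g : (Fin N → ℝ) → ℝ} (hf : Sm f) (hg : Sm g) (ε : ℝ)
    (t : Fin N → ℝ) : jet n (f + ε • g) t = jet n f t + ε • jet n g t := by
  funext I
  simp [jet, pdMulti_lin I.1 hf hg]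

lemma jet_sm {N : ℕ} (n : ℕ) {f : (Fin N → ℝ) → ℝ} (hf : Sm f) :
    ContDiff ℝ (⊤ : ℕ∞) (jet n f) :=
  contDiff_pi.2 fun I => hf.pdMulti I.1

lemma pjet_sm {N n : ℕ} {L : JetSpace N n → ℝ} (hL : ContDiff ℝ (⊤ : ℕ∞) L) (I : Fin N → ℕ)
    {u : (Fin N → ℝ) → ℝ} (hu : Sm u) : Sm (pjet L I u) := by
  unfold pjet
  by_cases h : ∑ m, I m ≤ n
  · simp only [h, dif_pos]
    have h1 : ContDiff ℝ (⊤ : ℕ∞) (fderiv ℝ L) := hL.fderiv_right (by simp)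
    exact (h1.comp (jet_sm n hu)).clm_apply contDiff_const
  · simp only [h, dif_neg, not_false_eq_true]
    exact contDiff_const

lemma pjet_eq_zero {N n : ℕ} (L : JetSpace N n → ℝ) (I : Fin N → ℕ)
    (u : (Fin N → ℝ) → ℝ) (h : n < ∑ m, I m) : pjet L I u = 0 := by
  funext t
  simp [pjet, not_le.2 h]

lemma sum_add_single {N : ℕ} (I : Fin N → ℕ) (i : Fin N) :
    ∑ m, (I + Pi.single i 1 : Fin N → ℕ) m = ∑ m, I m + 1 := by
  simp [Finset.sum_add_distrib, Finset.sum_pi_single']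

lemma sum_add_smul_single {N : ℕ} (I : Fin N → ℕ) (i : Fin N) (k : ℕ) :
    ∑ m, (I + k • Pi.single i 1 : Fin N → ℕ) m = ∑ m, I m + k := by
  simp [Finset.sum_add_distrib, ← Finset.mul_sum, Finset.sum_pi_single']

lemma varDer_eq {N n : ℕ} (i : Fin N) (L : JetSpace N n → ℝ) (I : Fin N → ℕ)
    (u : (Fin N → ℝ) → ℝ) (k : ℕ) (hk : n < ∑ m, I m + k) :
    varDer i L I u = ∑ α ∈ Finset.range k,
      (-1 : ℝ) ^ α • (pd i)^[α] (pjet L (I + α • Pi.single i 1) u) := by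
  unfold varDer
  apply finsum_eq_sum_of_support_subset
  intro α hα
  by_contra h
  apply hα
  have h' : k ≤ α := by simpa using h
  dsimp only
  rw [pjet_eq_zero, pd_iter_zero, smul_zero]
  rw [sum_add_smul_single]
  omega

lemma varDer_sm {N n : ℕ} (i : Fin N) {L : JetSpace N n → ℝ} (hL : ContDiff ℝ (⊤ : ℕ∞) L)
    (I : Fin N → ℕ) {u : (Fin N → ℝ) → ℝ} (hu : Sm u) : Sm (varDer i L I u) := by
  rw [varDer_eq i L I u (n + 1) (by omega)]
  exact Sm_sum _ _ fun α _ => ((pjet_sm hL _ hu).pd_iter i α).csmul _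

lemma varDer_eq_zero {N n : ℕ} (i : Fin N) (L : JetSpace N n → ℝ) (I : Fin N → ℕ)
    (u : (Fin N → ℝ) → ℝ) (h : n < ∑ m, I m) : varDer i L I u = 0 := by
  rw [varDer_eq i L I u 0 (by omega)]
  simp

lemma pd_varDer {N n : ℕ} (i : Fin N) {L : JetSpace N n → ℝ} (hL : ContDiff ℝ (⊤ : ℕ∞) L)
    (I : Fin N → ℕ) {u : (Fin N → ℝ) → ℝ} (hu : Sm u) :
    pd i (varDer i L (I + Pi.single i 1) u) = pjet L I u - varDer i L I u := by
  rw [varDer_eq i L I u (n + 2) (by omega), varDer_eq i L _ u (n + 1) (by omega),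
    Finset.sum_range_succ' _ (n + 1), pd_sum]
  · have : ∀ α : ℕ, pd i ((-1 : ℝ) ^ α • (pd i)^[α]
        (pjet L (I + Pi.single i 1 + α • Pi.single i 1) u)) =
        - ((-1 : ℝ) ^ (α + 1) • (pd i)^[α + 1] (pjet L (I + (α + 1) • Pi.single i 1) u)) := by
      intro α
      rw [pd_smul i _ ((pjet_sm hL _ hu).pd_iter i α), Function.iterate_succ_apply', pow_succ,
        add_assoc, ← succ_nsmul']
      simp
    simp only [this, Finset.sum_neg_distrib]
    simp
  · exact fun α _ => ((pjet_sm hL _ hu).pd_iter i α).csmul _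

/-- The finite set of multi-indices of order at most `n`. -/
def idx (N n : ℕ) : Finset (Fin N → ℕ) :=
  (Finset.univ : Finset {I : Fin N → ℕ // ∑ m, I m ≤ n}).map (Function.Embedding.subtype _)

lemma mem_idx {N n : ℕ} (I : Fin N → ℕ) : I ∈ idx N n ↔ ∑ m, I m ≤ n := by
  simp [idx]

/-- The boundary term of the first variation. -/
def bdry {N n : ℕ} (i : Fin N) (L : JetSpace N n → ℝ) (u φ : (Fin N → ℝ) → ℝ) :
    (Fin N → ℝ) → ℝ :=
  ∑ K ∈ idx N n, varDer i L (K + Pi.single i 1) u * pdMulti K φ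

/-- The bulk term of the first variation. -/
def bulk {N n : ℕ} (i : Fin N) (L : JetSpace N n → ℝ) (u φ : (Fin N → ℝ) → ℝ) :
    (Fin N → ℝ) → ℝ :=
  ∑ J ∈ (idx N n).filter (fun J => J i = 0), varDer i L J u * pdMulti J φ

lemma bdry_sm {N n : ℕ} (i : Fin N) {L : JetSpace N n → ℝ} (hL : ContDiff ℝ (⊤ : ℕ∞) L)
    {u φ : (Fin N → ℝ) → ℝ} (hu : Sm u) (hφ : Sm φ) : Sm (bdry i L u φ) :=
  Sm_sum _ _ fun K _ => (varDer_sm i hL _ hu).mul (hφ.pdMulti K)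

lemma bulk_sm {N n : ℕ} (i : Fin N) {L : JetSpace N n → ℝ} (hL : ContDiff ℝ (⊤ : ℕ∞) L)
    {u φ : (Fin N → ℝ) → ℝ} (hu : Sm u) (hφ : Sm φ) : Sm (bulk i L u φ) :=
  Sm_sum _ _ fun K _ => (varDer_sm i hL _ hu).mul (hφ.pdMulti K)

lemma shift_sum {N n : ℕ} (i : Fin N) (G : (Fin N → ℕ) → (Fin N → ℝ) → ℝ)
    (hG : ∀ I, n < ∑ m, I m → G I = 0) :
    ∑ K ∈ idx N n, G (K + Pi.single i 1) = ∑ I ∈ (idx N n).filter (fun J => ¬ J i = 0), G I := by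
  have h1 : ∑ K ∈ idx N n, G (K + Pi.single i 1)
      = ∑ I ∈ (idx N n).map ⟨fun K => K + Pi.single i 1, add_left_injective _⟩, G I := by
    rw [Finset.sum_map]
    rfl
  rw [h1]
  symm
  apply Finset.sum_subset
  · intro I hI
    rw [Finset.mem_filter, mem_idx] at hI
    rw [Finset.mem_map]
    have e : (I - Pi.single i 1) + Pi.single i 1 = I := by
      funext m
      by_cases hm : m = i
      · subst hm; simp; omega
      · simp [Pi.single_eq_of_ne hm]
    refine ⟨I - Pi.single i 1, ?_, e⟩
    rw [mem_idx]
    have := sum_add_single (I - Pi.single i 1) i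
    rw [e] at this
    omega
  · intro I hI hI'
    apply hG
    rw [Finset.mem_map] at hI
    obtain ⟨K, -, rfl⟩ := hI
    rw [Finset.mem_filter, mem_idx] at hI'
    by_contra h
    apply hI'
    refine ⟨not_lt.1 h, ?_⟩
    simp

lemma key_identity {N n : ℕ} (i : Fin N) {L : JetSpace N n → ℝ} (hL : ContDiff ℝ (⊤ : ℕ∞) L)
    {u φ : (Fin N → ℝ) → ℝ} (hu : Sm u) (hφ : Sm φ) :
    ∑ I ∈ idx N n, pjet L I u * pdMulti I φ = bulk i L u φ + pd i (bdry i L u φ) := by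
  unfold bdry
  have h0 := pd_sum i (idx N n) (fun K : Fin N → ℕ => varDer i L (K + Pi.single i 1) u * pdMulti K φ)
    (fun K _ => (varDer_sm i hL _ hu).mul (hφ.pdMulti K))
  rw [h0]
  have h : ∀ K : Fin N → ℕ, pd i (varDer i L (K + Pi.single i 1) u * pdMulti K φ) =
      pjet L K u * pdMulti K φ - varDer i L K u * pdMulti K φ
        + varDer i L (K + Pi.single i 1) u * pdMulti (K + Pi.single i 1) φ := by
    intro K
    rw [pd_mul i (varDer_sm i hL _ hu) (hφ.pdMulti K), pd_varDer i hL K hu,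
      pdMulti_add_single K i hφ, sub_mul]
  simp only [h, Finset.sum_add_distrib, Finset.sum_sub_distrib]
  rw [shift_sum i (fun I => varDer i L I u * pdMulti I φ)
    (fun I hI => by simp [varDer_eq_zero i L I u hI])]
  rw [← Finset.sum_filter_add_sum_filter_not (idx N n) (fun J => J i = 0)
    (fun I => varDer i L I u * pdMulti I φ)]
  unfold bulk
  abel

lemma fderiv_jet {N n : ℕ} (L : JetSpace N n → ℝ) (u φ : (Fin N → ℝ) → ℝ) (t : Fin N → ℝ) :
    fderiv ℝ L (jet n u t) (jet n φ t)
      = (∑ I ∈ idx N n, pjet L I u * pdMulti I φ) t := by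
  classical
  rw [Finset.sum_apply, idx, Finset.sum_map]
  conv_lhs => rw [pi_eq_sum_univ' (jet n φ t)]
  rw [map_sum]
  refine Finset.sum_congr rfl fun I _ => ?_
  rw [map_smul]
  simp only [Function.Embedding.subtype_apply, Pi.mul_apply, smul_eq_mul, pjet, dif_pos I.2, jet]
  rw [mul_comm]

lemma hasDerivAt_line {N : ℕ} (i : Fin N) {f : (Fin N → ℝ) → ℝ} (hf : Sm f) (q : Fin N → ℝ)
    (s : ℝ) : HasDerivAt (fun s : ℝ => f (q + s • unitVec i)) (pd i f (q + s • unitVec i)) s := by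
  have h1 : HasDerivAt (fun s : ℝ => q + s • (unitVec i : Fin N → ℝ)) (unitVec i) s := by
    simpa using ((hasDerivAt_id s).smul_const (unitVec i : Fin N → ℝ)).const_add q
  exact (hf.diff _).hasFDerivAt.comp_hasDerivAt s h1

lemma line_cont {N : ℕ} (i : Fin N) (q : Fin N → ℝ) :
    Continuous (fun s : ℝ => q + s • (unitVec i : Fin N → ℝ)) := by fun_prop

lemma seg_variation {N n : ℕ} (i : Fin N) {L : JetSpace N n → ℝ} (hL : ContDiff ℝ (⊤ : ℕ∞) L)
    {u φ : (Fin N → ℝ) → ℝ} (hu : Sm u) (hφ : Sm φ) (q : Fin N → ℝ) (c : ℝ) :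
    HasDerivAt (fun ε : ℝ => ∫ s in (0:ℝ)..c, jev L (u + ε • φ) (q + s • unitVec i))
      ((∫ s in (0:ℝ)..c, bulk i L u φ (q + s • unitVec i))
        + (bdry i L u φ (q + c • unitVec i) - bdry i L u φ q)) 0 := by
  have hval : (∫ s in (0:ℝ)..c, bulk i L u φ (q + s • unitVec i))
        + (bdry i L u φ (q + c • unitVec i) - bdry i L u φ q)
      = ∫ s in (0:ℝ)..c, fderiv ℝ L (jet n u (q + s • unitVec i) + (0:ℝ) • jet n φ (q + s • unitVec i))
          (jet n φ (q + s • unitVec i)) := by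
    have hc1 : Continuous (fun s : ℝ => bulk i L u φ (q + s • unitVec i)) :=
      (bulk_sm i hL hu hφ).continuous.comp (line_cont i q)
    have hc2 : Continuous (fun s : ℝ => pd i (bdry i L u φ) (q + s • unitVec i)) :=
      ((bdry_sm i hL hu hφ).pd i).continuous.comp (line_cont i q)
    have e2 := intervalIntegral.integral_eq_sub_of_hasDerivAt
      (fun s _ => hasDerivAt_line i (bdry_sm i hL hu hφ) q s) (hc2.intervalIntegrable 0 c)
    simp only [zero_smul, add_zero, fderiv_jet, key_identity i hL hu hφ, Pi.add_apply]
    rw [intervalIntegral.integral_add (hc1.intervalIntegrable 0 c) (hc2.intervalIntegrable 0 c), e2]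
    simp
  rw [hval]
  have hju : Continuous (fun s : ℝ => jet n u (q + s • unitVec i)) :=
    (jet_sm n hu).continuous.comp (line_cont i q)
  have hjφ : Continuous (fun s : ℝ => jet n φ (q + s • unitVec i)) :=
    (jet_sm n hφ).continuous.comp (line_cont i q)
  have hLd : Differentiable ℝ L := hL.differentiable (by simp)
  have hLc : Continuous (fderiv ℝ L) := hL.continuous_fderiv (by simp)
  simp only [jev, jet_lin n hu hφ]
  have hF' : Continuous (fun x : ℝ × ℝ => fderiv ℝ L
      (jet n u (q + x.2 • unitVec i) + x.1 • jet n φ (q + x.2 • unitVec i))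
      (jet n φ (q + x.2 • unitVec i))) := by
    have h1 : Continuous (fun x : ℝ × ℝ => jet n u (q + x.2 • unitVec i)) :=
      hju.comp continuous_snd
    have h2 : Continuous (fun x : ℝ × ℝ => jet n φ (q + x.2 • unitVec i)) :=
      hjφ.comp continuous_snd
    exact (hLc.comp (h1.add (continuous_fst.smul h2))).clm_apply h2
  obtain ⟨C, hC⟩ := ((isCompact_Icc (a := (-1:ℝ)) (b := 1)).prod
    (isCompact_uIcc (a := (0:ℝ)) (b := c))).exists_bound_of_continuousOn hF'.continuousOn
  have hFc : ∀ ε : ℝ, Continuous (fun s : ℝ =>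
      L (jet n u (q + s • unitVec i) + ε • jet n φ (q + s • unitVec i))) := fun ε =>
    hLd.continuous.comp (hju.add (hjφ.const_smul ε))
  refine (intervalIntegral.hasDerivAt_integral_of_dominated_loc_of_deriv_le
    (F' := fun ε s => fderiv ℝ L
      (jet n u (q + s • unitVec i) + ε • jet n φ (q + s • unitVec i))
      (jet n φ (q + s • unitVec i))) (bound := fun _ => C)
    (Icc_mem_nhds (show (-1:ℝ) < 0 by norm_num) (show (0:ℝ) < 1 by norm_num))
    (Filter.Eventually.of_forall fun ε => (hFc ε).aestronglyMeasurable)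
    ((hFc 0).intervalIntegrable 0 c) ?_ ?_ intervalIntegrable_const ?_).2
  · exact (hF'.comp (Continuous.prodMk_right (0:ℝ))).aestronglyMeasurable
  · exact Filter.Eventually.of_forall fun s hs ε hε =>
      hC (ε, s) ⟨hε, Set.uIoc_subset_uIcc hs⟩
  · refine Filter.Eventually.of_forall fun s _ ε _ => ?_
    have h1 : HasDerivAt (fun ε : ℝ => jet n u (q + s • unitVec i)
        + ε • jet n φ (q + s • unitVec i)) (jet n φ (q + s • unitVec i)) ε := by
      simpa using ((hasDerivAt_id ε).smul_const
        (jet n φ (q + s • unitVec i))).const_add (jet n u (q + s • unitVec i))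
    exact (hLd _).hasFDerivAt.comp_hasDerivAt ε h1

lemma action_variation {N n : ℕ} {L : Fin N → JetSpace N n → ℝ}
    (hL : ∀ m, ContDiff ℝ (⊤ : ℕ∞) (L m))
    {u φ : (Fin N → ℝ) → ℝ} (hu : Sm u) (hφ : Sm φ) (p : Fin N → ℝ) (i j : Fin N) (a b : ℝ) :
    deriv (fun ε : ℝ =>
          (∫ s in (0:ℝ)..a, jev (L i) (u + ε • φ) (p - (a - s) • unitVec i)) +
          (∫ s in (0:ℝ)..b, jev (L j) (u + ε • φ) (p + s • unitVec j))) 0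
    = ((∫ s in (0:ℝ)..a, bulk i (L i) u φ (p - (a - s) • unitVec i))
        + (bdry i (L i) u φ p - bdry i (L i) u φ (p - a • unitVec i)))
      + ((∫ s in (0:ℝ)..b, bulk j (L j) u φ (p + s • unitVec j))
        + (bdry j (L j) u φ (p + b • unitVec j) - bdry j (L j) u φ p)) := by
  have e : ∀ s : ℝ, p - (a - s) • (unitVec i : Fin N → ℝ) = (p - a • unitVec i) + s • unitVec i := by
    intro s
    rw [sub_smul]
    abel
  simp only [e]
  have h := (seg_variation i (hL i) hu hφ (p - a • unitVec i) a).add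
    (seg_variation j (hL j) hu hφ p b)
  rw [sub_add_cancel] at h
  exact h.deriv

lemma pd_tsupport {N : ℕ} (i : Fin N) (φ : (Fin N → ℝ) → ℝ) :
    tsupport (pd i φ) ⊆ tsupport φ := by
  refine closure_minimal (fun x hx => ?_) (isClosed_tsupport φ)
  by_contra h
  apply hx
  have : fderiv ℝ φ x = 0 := image_eq_zero_of_notMem_tsupport
    (fun h' => h (tsupport_fderiv_subset ℝ h'))
  simp [pd, this]

lemma pdMulti_tsupport {N : ℕ} {φ : (Fin N → ℝ) → ℝ} (hφ : Sm φ) (I : Fin N → ℕ) :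
    tsupport (pdMulti I φ) ⊆ tsupport φ := by
  induction I using multi_induction with
  | h0 => rw [pdMulti_zero]
  | hs I i ih =>
    rw [pdMulti_add_single I i hφ]
    exact (pd_tsupport i _).trans ih

lemma pdMulti_off {N : ℕ} {φ : (Fin N → ℝ) → ℝ} (hφ : Sm φ) (I : Fin N → ℕ) {t : Fin N → ℝ}
    (ht : t ∉ tsupport φ) : pdMulti I φ t = 0 :=
  image_eq_zero_of_notMem_tsupport fun h => ht (pdMulti_tsupport hφ I h)

lemma bdry_off {N n : ℕ} (i : Fin N) (L : JetSpace N n → ℝ)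
    (u : (Fin N → ℝ) → ℝ) {φ : (Fin N → ℝ) → ℝ} (hφ : Sm φ) {t : Fin N → ℝ}
    (ht : t ∉ tsupport φ) : bdry i L u φ t = 0 := by
  simp [bdry, pdMulti_off hφ _ ht]

lemma bulk_off {N n : ℕ} (i : Fin N) (L : JetSpace N n → ℝ)
    (u : (Fin N → ℝ) → ℝ) {φ : (Fin N → ℝ) → ℝ} (hφ : Sm φ) {t : Fin N → ℝ}
    (ht : t ∉ tsupport φ) : bulk i L u φ t = 0 := by
  simp [bulk, pdMulti_off hφ _ ht]

lemma exists_test (l : ℕ) : ∃ g : ℝ → ℝ, ContDiff ℝ (⊤ : ℕ∞) g ∧ (∀ x, 1 / 2 ≤ |x| → g x = 0) ∧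
    ∀ k : ℕ, deriv^[k] g 0 = if k = l then 1 else 0 := by
  let f : ContDiffBump (0 : ℝ) := ⟨1 / 4, 1 / 2, by norm_num, by norm_num⟩
  refine ⟨fun x => f x * ((l.factorial : ℝ)⁻¹ * x ^ l), ?_, ?_, ?_⟩
  · exact f.contDiff.mul (contDiff_const.mul (contDiff_id.pow l))
  · intro x hx
    have : f x = 0 := f.zero_of_le_dist (by simpa [f] using hx)
    simp [this]
  · intro k
    rw [← iteratedDeriv_eq_iterate]
    have h : (fun x => f x * ((l.factorial : ℝ)⁻¹ * x ^ l))
        =ᶠ[nhds 0] fun x => (l.factorial : ℝ)⁻¹ * x ^ l := by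
      filter_upwards [f.eventuallyEq_one] with x hx
      simp [hx]
    rw [h.iteratedDeriv_eq, iteratedDeriv_const_mul_field, iteratedDeriv_fun_pow_zero]
    have : (l.factorial : ℝ) ≠ 0 := by positivity
    split_ifs <;> simp [this]

/-- A product test function centered at `p`. -/
def prodFn {N : ℕ} (p : Fin N → ℝ) (g : Fin N → ℝ → ℝ) : (Fin N → ℝ) → ℝ :=
  fun t => ∏ m, g m (t m - p m)

lemma prodFn_sm {N : ℕ} (p : Fin N → ℝ) {g : Fin N → ℝ → ℝ}
    (hg : ∀ m, ContDiff ℝ (⊤ : ℕ∞) (g m)) : Sm (prodFn p g) := by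
  unfold prodFn
  refine contDiff_prod fun m _ => (hg m).comp ?_
  exact (contDiff_apply ℝ ℝ m).sub contDiff_const

lemma pd_prodFn {N : ℕ} (p : Fin N → ℝ) (i : Fin N) {g : Fin N → ℝ → ℝ}
    (hg : ∀ m, ContDiff ℝ (⊤ : ℕ∞) (g m)) :
    pd i (prodFn p g) = prodFn p (Function.update g i (deriv (g i))) := by
  funext t
  have h1 := hasDerivAt_line i (prodFn_sm p hg) t 0
  have h2 : (fun s : ℝ => prodFn p g (t + s • unitVec i))
      = fun s : ℝ => g i (t i - p i + s) * ∏ m ∈ Finset.univ.erase i, g m (t m - p m) := by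
    funext s
    unfold prodFn
    rw [← Finset.mul_prod_erase _ _ (Finset.mem_univ i)]
    congr 1
    · simp [unitVec]
      ring_nf
    · refine Finset.prod_congr rfl fun m hm => ?_
      simp [unitVec, Pi.single_eq_of_ne (Finset.ne_of_mem_erase hm)]
  have h3 : HasDerivAt (fun s : ℝ => g i (t i - p i + s)) (deriv (g i) (t i - p i)) 0 := by
    have : HasDerivAt (g i) (deriv (g i) (t i - p i)) (t i - p i + 0) := by
      rw [add_zero]
      exact ((hg i).differentiable (by simp) _).hasDerivAt
    exact this.comp_const_add _ _
  rw [h2] at h1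
  have h4 := h1.unique (h3.mul_const _)
  rw [zero_smul, add_zero] at h4
  rw [h4]
  unfold prodFn
  rw [← Finset.mul_prod_erase _ _ (Finset.mem_univ i)]
  congr 1
  · simp
  · refine Finset.prod_congr rfl fun m hm => ?_
    simp [Function.update_of_ne (Finset.ne_of_mem_erase hm)]

lemma iter_deriv_sm {g : ℝ → ℝ} (hg : ContDiff ℝ (⊤ : ℕ∞) g) (k : ℕ) :
    ContDiff ℝ (⊤ : ℕ∞) (deriv^[k] g) := by
  induction k generalizing g with
  | zero => exact hg
  | succ k ih => exact ih (contDiff_infty_iff_deriv.1 hg).2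

lemma pdMulti_prodFn {N : ℕ} (p : Fin N → ℝ) {g : Fin N → ℝ → ℝ}
    (hg : ∀ m, ContDiff ℝ (⊤ : ℕ∞) (g m)) (I : Fin N → ℕ) :
    pdMulti I (prodFn p g) = prodFn p (fun m => deriv^[I m] (g m)) := by
  induction I using multi_induction with
  | h0 => simp [pdMulti_zero]
  | hs I i ih =>
    rw [pdMulti_add_single I i (prodFn_sm p hg), ih,
      pd_prodFn p i (fun m => iter_deriv_sm (hg m) _)]
    congr 1
    funext m
    by_cases hm : m = i
    · subst hm
      simp [Function.iterate_succ_apply']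
    · simp [hm]

lemma prodFn_tsupport {N : ℕ} (p : Fin N → ℝ) {g : Fin N → ℝ → ℝ}
    (hg : ∀ m x, 1 / 2 ≤ |x| → g m x = 0) :
    tsupport (prodFn p g) ⊆ Metric.closedBall p (1 / 2) := by
  refine closure_minimal (fun t ht => ?_) Metric.isClosed_closedBall
  rw [Metric.mem_closedBall, dist_pi_le_iff (by norm_num)]
  intro m
  by_contra h
  apply ht
  refine Finset.prod_eq_zero (Finset.mem_univ m) (hg m _ ?_)
  rw [Real.dist_eq] at h
  exact (not_le.1 h).le

lemma prodFn_compact {N : ℕ} (p : Fin N → ℝ) {g : Fin N → ℝ → ℝ}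
    (hg : ∀ m x, 1 / 2 ≤ |x| → g m x = 0) : HasCompactSupport (prodFn p g) :=
  (isCompact_closedBall p (1 / 2)).of_isClosed_subset (isClosed_tsupport _) (prodFn_tsupport p hg)

lemma prodFn_notMem {N : ℕ} (p : Fin N → ℝ) {g : Fin N → ℝ → ℝ}
    (hg : ∀ m x, 1 / 2 ≤ |x| → g m x = 0) (t : Fin N → ℝ) (m : Fin N) (h : |t m - p m| = 1) :
    t ∉ tsupport (prodFn p g) := by
  intro ht
  have h1 := prodFn_tsupport p hg ht
  rw [Metric.mem_closedBall, dist_pi_le_iff (by norm_num)] at h1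
  have := h1 m
  rw [Real.dist_eq, h] at this
  norm_num at this

/-- Fundamental lemma of the calculus of variations, in the form needed here. -/
lemma fund_lemma {f : ℝ → ℝ} (hf : Continuous f)
    (h : ∀ η : ℝ → ℝ, ContDiff ℝ (⊤ : ℕ∞) η → (∀ x, 1 / 2 ≤ |x| → η x = 0) →
      ∫ s in (0:ℝ)..2, f (s - 1) * η (s - 1) = 0) : f 0 = 0 := by
  by_contra h0
  have hev : ∀ᶠ x in nhds (0:ℝ), 0 < f x * f 0 := by
    have : Continuous fun x => f x * f 0 := by fun_prop
    exact this.continuousAt.eventually (lt_mem_nhds (mul_self_pos.2 h0))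
  obtain ⟨δ, hδ, hball⟩ := Metric.eventually_nhds_iff.1 hev
  let r := min δ (1 / 2)
  have hr : 0 < r := by positivity
  let η : ContDiffBump (0 : ℝ) := ⟨r / 2, r, by positivity, by linarith⟩
  have h1 := h (fun x => f 0 * η x) (contDiff_const.mul η.contDiff) (by
    intro x hx
    have : η x = 0 := η.zero_of_le_dist (by
      have : r ≤ 1 / 2 := min_le_right _ _
      simpa [η] using this.trans hx)
    simp [this])
  have h2 : 0 < ∫ s in (0:ℝ)..2, f (s - 1) * (f 0 * η (s - 1)) := by
    refine intervalIntegral.integral_pos (by norm_num) ?_ ?_ ?_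
    · have := η.continuous
      exact Continuous.continuousOn (by fun_prop)
    · intro s _
      by_cases hs : dist (s - 1) 0 < δ
      · have := hball hs
        rw [← mul_assoc]
        exact mul_nonneg this.le η.nonneg
      · have : η (s - 1) = 0 := η.zero_of_le_dist ((min_le_left _ _).trans (not_lt.1 hs))
        simp [this]
    · refine ⟨1, by norm_num, ?_⟩
      have : η (1 - 1) = 1 := by
        rw [sub_self]
        exact η.one_of_mem_closedBall (Metric.mem_closedBall_self (by positivity))
      rw [this]
      simpa using mul_self_pos.2 h0
  linarith

lemma bulk_eq_test {N n : ℕ} (i : Fin N) (L : JetSpace N n → ℝ) (u : (Fin N → ℝ) → ℝ)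
    (J : Fin N → ℕ) (hJ : J i = 0) (p : Fin N → ℝ) {g : Fin N → ℝ → ℝ}
    (hg : ∀ m, ContDiff ℝ (⊤ : ℕ∞) (g m))
    (hg' : ∀ m, m ≠ i → ∀ k : ℕ, deriv^[k] (g m) 0 = if k = J m then 1 else 0) (s : ℝ) :
    bulk i L u (prodFn p g) (p + s • unitVec i)
      = varDer i L J u (p + s • unitVec i) * g i s := by
  unfold bulk
  rw [Finset.sum_apply]
  have hval : ∀ J' : Fin N → ℕ, J' i = 0 → pdMulti J' (prodFn p g) (p + s • unitVec i)
      = if J' = J then g i s else 0 := by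
    intro J' hJ'
    rw [pdMulti_prodFn p hg]
    unfold prodFn
    rw [← Finset.mul_prod_erase _ _ (Finset.mem_univ i)]
    have e1 : ∀ m ∈ Finset.univ.erase i, deriv^[J' m] (g m)
        ((p + s • (unitVec i : Fin N → ℝ)) m - p m) = if J' m = J m then 1 else 0 := by
      intro m hm
      have hm' := Finset.ne_of_mem_erase hm
      rw [← hg' m hm']
      simp [unitVec, Pi.single_eq_of_ne hm']
    rw [Finset.prod_congr rfl e1]
    dsimp only
    rw [hJ']
    by_cases hJJ : J' = J
    · subst hJJ
      simp [unitVec]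
    · rw [if_neg hJJ]
      obtain ⟨m, hm⟩ := Function.ne_iff.1 hJJ
      have hmi : m ≠ i := by
        rintro rfl
        exact hm (hJ'.trans hJ.symm)
      rw [Finset.prod_eq_zero (i := m) (by simp [hmi]) (by simp [hm]), mul_zero]
  rw [Finset.sum_eq_single J]
  · rw [Pi.mul_apply, hval J hJ, if_pos rfl]
  · intro J' hJ' hne
    rw [Pi.mul_apply, hval J' (Finset.mem_filter.1 hJ').2, if_neg hne, mul_zero]
  · intro hnot
    have : n < ∑ m, J m := by
      by_contra hle
      exact hnot (Finset.mem_filter.2 ⟨(mem_idx J).2 (not_lt.1 hle), hJ⟩)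
    simp [varDer_eq_zero i L J u this]

lemma bdry_eq_test {N n : ℕ} (i : Fin N) (L : JetSpace N n → ℝ) (u : (Fin N → ℝ) → ℝ)
    (K : Fin N → ℕ) (p : Fin N → ℝ) {g : Fin N → ℝ → ℝ}
    (hg : ∀ m, ContDiff ℝ (⊤ : ℕ∞) (g m))
    (hg' : ∀ m, ∀ k : ℕ, deriv^[k] (g m) 0 = if k = K m then 1 else 0) :
    bdry i L u (prodFn p g) p = varDer i L (K + Pi.single i 1) u p := by
  unfold bdry
  rw [Finset.sum_apply]
  have hval : ∀ J' : Fin N → ℕ, pdMulti J' (prodFn p g) p = if J' = K then 1 else 0 := by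
    intro J'
    rw [pdMulti_prodFn p hg]
    unfold prodFn
    simp only [sub_self, hg']
    by_cases hJJ : J' = K
    · subst hJJ
      simp
    · rw [if_neg hJJ]
      obtain ⟨m, hm⟩ := Function.ne_iff.1 hJJ
      exact Finset.prod_eq_zero (Finset.mem_univ m) (by simp [hm])
  rw [Finset.sum_eq_single K]
  · rw [Pi.mul_apply, hval K, if_pos rfl, mul_one]
  · intro J' hJ' hne
    rw [Pi.mul_apply, hval J', if_neg hne, mul_zero]
  · intro hnot
    have : n < ∑ m, (K + Pi.single i 1 : Fin N → ℕ) m := by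
      rw [mem_idx] at hnot
      rw [sum_add_single]
      omega
    simp [varDer_eq_zero i L _ u this]

lemma bulk_eq_zero {N n : ℕ} (i : Fin N) (L : JetSpace N n → ℝ) (u φ : (Fin N → ℝ) → ℝ)
    (h : ∀ I : Fin N → ℕ, I i = 0 → ∀ t : Fin N → ℝ, varDer i L I u t = 0) (t : Fin N → ℝ) :
    bulk i L u φ t = 0 := by
  unfold bulk
  rw [Finset.sum_apply]
  refine Finset.sum_eq_zero fun J hJ => ?_
  rw [Pi.mul_apply, h J (Finset.mem_filter.1 hJ).2, zero_mul]

/-- multi-time Euler–Lagrange equations for curves. For a Lagrangian 1-form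
`(L_1, …, L_N)` of jet order `n` and a smooth field `u`, stationarity of the action on
every L-shaped curve (for every corner `p`, directions `i ≠ j` and lengths `a, b > 0`,
and every smooth compactly supported variation `φ` whose support avoids the two outer
endpoints) is equivalent to the multi-time Euler–Lagrange equations
`δ_iL_i/δu_I = 0` (for `I_i = 0`) and `δ_iL_i/δu_{Ii} = δ_jL_j/δu_{Ij}`. -/
theorem stmt_0 (N n : ℕ) (hN : 2 ≤ N)
    (L : Fin N → JetSpace N n → ℝ) (hL : ∀ m, ContDiff ℝ (⊤ : ℕ∞) (L m))
    (u : (Fin N → ℝ) → ℝ) (hu : ContDiff ℝ (⊤ : ℕ∞) u) :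
    (∀ (p : Fin N → ℝ) (i j : Fin N), i ≠ j → ∀ a b : ℝ, 0 < a → 0 < b →
      ∀ φ : (Fin N → ℝ) → ℝ, ContDiff ℝ (⊤ : ℕ∞) φ → HasCompactSupport φ →
        p - a • unitVec i ∉ tsupport φ → p + b • unitVec j ∉ tsupport φ →
        deriv (fun ε : ℝ =>
          (∫ s in (0:ℝ)..a, jev (L i) (u + ε • φ) (p - (a - s) • unitVec i)) +
          (∫ s in (0:ℝ)..b, jev (L j) (u + ε • φ) (p + s • unitVec j))) 0 = 0)
    ↔
    ((∀ (i : Fin N) (I : Fin N → ℕ), I i = 0 →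
        ∀ t : Fin N → ℝ, varDer i (L i) I u t = 0) ∧
      (∀ i j : Fin N, i ≠ j → ∀ I : Fin N → ℕ, ∀ t : Fin N → ℝ,
        varDer i (L i) (I + Pi.single i 1) u t
          = varDer j (L j) (I + Pi.single j 1) u t)) := by
  constructor
  · intro H
    have first : ∀ (i : Fin N) (I : Fin N → ℕ), I i = 0 →
        ∀ t : Fin N → ℝ, varDer i (L i) I u t = 0 := by
      intro i J hJ p
      haveI : Nontrivial (Fin N) := Fin.nontrivial_iff_two_le.2 hN
      obtain ⟨j, hji⟩ := exists_ne i
      choose g0 hg0 hg0s hg0d using exists_test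
      have hc : Continuous (fun s : ℝ => varDer i (L i) J u (p + s • unitVec i)) :=
        (varDer_sm i (hL i) J hu).continuous.comp (line_cont i p)
      have := fund_lemma hc ?_
      · simpa using this
      intro η hη hηs
      let g : Fin N → ℝ → ℝ := fun m => if m = i then η else g0 (J m)
      have hg : ∀ m, ContDiff ℝ (⊤ : ℕ∞) (g m) := by
        intro m
        by_cases hm : m = i
        · simpa [g, hm] using hη
        · simpa [g, hm] using hg0 (J m)
      have hgs : ∀ m x, 1 / 2 ≤ |x| → g m x = 0 := by
        intro m x hx
        by_cases hm : m = i
        · simpa [g, hm] using hηs x hx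
        · simpa [g, hm] using hg0s (J m) x hx
      have hgd : ∀ m, m ≠ i → ∀ k : ℕ, deriv^[k] (g m) 0 = if k = J m then 1 else 0 := by
        intro m hm k
        simpa [g, hm] using hg0d (J m) k
      have hgi : g i = η := by simp [g]
      have hφ := prodFn_sm p hg
      have hend : ∀ s : ℝ, p + unitVec i + s • unitVec j ∉ tsupport (prodFn p g) := by
        intro s
        apply prodFn_notMem p hgs _ i
        simp [unitVec, Pi.single_eq_of_ne (Ne.symm hji)]
      have hst : p + unitVec i - (2:ℝ) • unitVec i ∉ tsupport (prodFn p g) := by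
        apply prodFn_notMem p hgs _ i
        have e : p i + 1 - 2 - p i = -1 := by ring
        simp [unitVec, e]
      have hcorner : p + unitVec i ∉ tsupport (prodFn p g) := by simpa using hend 0
      have h1 := H (p + unitVec i) i j (Ne.symm hji) 2 1 (by norm_num) (by norm_num)
        (prodFn p g) hφ (prodFn_compact p hgs) hst (hend 1)
      rw [action_variation hL hu hφ, bdry_off i _ u hφ hcorner, bdry_off i _ u hφ hst,
        bdry_off j _ u hφ hcorner, bdry_off j _ u hφ (hend 1)] at h1
      simp only [bulk_off j (L j) u hφ (hend _)] at h1
      have e : ∀ s : ℝ, p + unitVec i - (2 - s) • (unitVec i : Fin N → ℝ)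
          = p + (s - 1) • unitVec i := by
        intro s
        module
      simp only [e, bulk_eq_test i (L i) u J hJ p hg hgd, hgi] at h1
      simpa using h1
    refine ⟨first, ?_⟩
    intro i j hij K p
    choose g0 hg0 hg0s hg0d using exists_test
    let g : Fin N → ℝ → ℝ := fun m => g0 (K m)
    have hg : ∀ m, ContDiff ℝ (⊤ : ℕ∞) (g m) := fun m => hg0 (K m)
    have hgs : ∀ m x, 1 / 2 ≤ |x| → g m x = 0 := fun m => hg0s (K m)
    have hgd : ∀ m, ∀ k : ℕ, deriv^[k] (g m) 0 = if k = K m then 1 else 0 :=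
      fun m => hg0d (K m)
    have hφ := prodFn_sm p hg
    have h1 : p - (1:ℝ) • unitVec i ∉ tsupport (prodFn p g) := by
      apply prodFn_notMem p hgs _ i
      simp [unitVec]
    have h2 : p + (1:ℝ) • unitVec j ∉ tsupport (prodFn p g) := by
      apply prodFn_notMem p hgs _ j
      simp [unitVec]
    have h3 := H p i j hij 1 1 (by norm_num) (by norm_num) (prodFn p g) hφ
      (prodFn_compact p hgs) h1 h2
    rw [action_variation hL hu hφ, bdry_off i _ u hφ h1, bdry_off j _ u hφ h2,
      bdry_eq_test i (L i) u K p hg hgd, bdry_eq_test j (L j) u K p hg hgd] at h3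
    simp only [bulk_eq_zero i (L i) u _ (first i), bulk_eq_zero j (L j) u _ (first j)] at h3
    simp at h3
    linarith
  · rintro ⟨h1, h2⟩ p i j hij a b _ _ φ hφ _ hpa hpb
    rw [action_variation hL hu hφ, bdry_off i _ u hφ hpa, bdry_off j _ u hφ hpb]
    simp only [bulk_eq_zero i (L i) u _ (h1 i), bulk_eq_zero j (L j) u _ (h1 j)]
    have : bdry i (L i) u φ p = bdry j (L j) u φ p := by
      unfold bdry
      simp only [Finset.sum_apply, Pi.mul_apply]
      exact Finset.sum_congr rfl fun K _ => by rw [h2 i j hij K p]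
    simp [this]
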